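/- (Mollification estimate.) In the normalized setting, let v(x,y,z) := e^{z} u(x,y) on (−5,6)×B_3(0)×ℝ. Let η : ℝ → [0,1] be a smooth function supported in [−1,1] with ∫_{−1}^{1} η(x') dx' = 1 and ‖η'‖_∞ ≤ 2. Let ε ∈ (0,1) and let δ ∈ (0, 1/(2√(N−1))) be such that |β(y) − β(y')| ≤ ε² whenever y, y' ∈ B_{5/2}(0) and |y − y'| ≤ √(N−1)·δ. Define the mollifier η^{ε}(x,y,z) := ε^{−2} δ^{1−N} η(x/ε) η(z/ε) ∏_{n=1}^{N−1} η(y_n/δ) and set v^{ε} := v * η^{ε} (convolution in all N+1 variables, well defined at the points considered). Then for every (x,y,z) ∈ (−4,5)×B_2(0)×ℝ, one has Δ_y v^{ε}(x,y,z) + β(y) ∂_x v^{ε}(x,y,z) + ∂_z v^{ε}(x,y,z) ≥ −2^{N+2} ε e^{z+ε} ‖u‖_∞. -/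

import Mathlib

open MeasureTheory Set Metric ProbabilityTheory

noncomputable section

/-- `ℝ^{N-1}`, the space of the variable `y`. -/
abbrev Euc (N : ℕ) : Type := EuclideanSpace ℝ (Fin (N - 1))

/-- The partial derivative `∂φ/∂x` of a function on `ℝ × ℝ^{N-1}`. -/
def dX {N : ℕ} (φ : ℝ × Euc N → ℝ) (p : ℝ × Euc N) : ℝ :=
  fderiv ℝ φ p (1, 0)

/-- The Laplacian `Δ_y` in the `y`-variables. -/
def lapY {N : ℕ} (φ : ℝ × Euc N → ℝ) (p : ℝ × Euc N) : ℝ :=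
  ∑ i : Fin (N - 1),
    fderiv ℝ (fun q => fderiv ℝ φ q ((0 : ℝ), EuclideanSpace.single i (1 : ℝ))) p
      ((0 : ℝ), EuclideanSpace.single i (1 : ℝ))

/-- `u` is a distributional solution of `Δ_y u + β(y) u_x + γ(x,y) u = 0` on `S`:
for every test function `φ ∈ C_c^∞(S)`, `∫_S u · (Δ_y φ − β φ_x + γ φ) = 0`. -/
def IsDistribSolution {N : ℕ} (S : Set (ℝ × Euc N)) (β : Euc N → ℝ)
    (γ u : ℝ × Euc N → ℝ) : Prop :=
  ∀ φ : ℝ × Euc N → ℝ, ContDiff ℝ (⊤ : ℕ∞) φ → HasCompactSupport φ → tsupport φ ⊆ S →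
    ∫ p in S, u p * (lapY φ p - β p.2 * dX φ p + γ p * φ p) = 0

/-- The cylinder `(−5,6) × B_3(0)` of the normalized setting. -/
def cylD (N : ℕ) : Set (ℝ × Euc N) := Ioo (-5 : ℝ) 6 ×ˢ ball (0 : Euc N) 3

/-- `‖β‖_∞ := sup_{B_3(0)} |β|`. -/
def supNormβ {N : ℕ} (β : Euc N → ℝ) : ℝ := sSup ((fun y => |β y|) '' ball (0 : Euc N) 3)

/-- `A_d^+ := {y ∈ B_1(0) | β(y) > d}`. -/
def Aplus {N : ℕ} (β : Euc N → ℝ) (d : ℝ) : Set (Euc N) :=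
  {y ∈ ball (0 : Euc N) 1 | d < β y}

/-- `A_d^− := {y ∈ B_1(0) | −β(y) > d}`. -/
def Aminus {N : ℕ} (β : Euc N → ℝ) (d : ℝ) : Set (Euc N) :=
  {y ∈ ball (0 : Euc N) 1 | d < -β y}

/-- The partial derivative `∂φ/∂x` of a function on `ℝ × ℝ^{N-1} × ℝ`. -/
def dX3 {N : ℕ} (φ : ℝ × Euc N × ℝ → ℝ) (p : ℝ × Euc N × ℝ) : ℝ :=
  fderiv ℝ φ p (1, 0, 0)

/-- The partial derivative `∂φ/∂z` of a function on `ℝ × ℝ^{N-1} × ℝ`. -/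
def dZ3 {N : ℕ} (φ : ℝ × Euc N × ℝ → ℝ) (p : ℝ × Euc N × ℝ) : ℝ :=
  fderiv ℝ φ p (0, 0, 1)

/-- The Laplacian `Δ_y` in the `y`-variables of a function on `ℝ × ℝ^{N-1} × ℝ`. -/
def lapY3 {N : ℕ} (φ : ℝ × Euc N × ℝ → ℝ) (p : ℝ × Euc N × ℝ) : ℝ :=
  ∑ i : Fin (N - 1),
    fderiv ℝ (fun q => fderiv ℝ φ q ((0 : ℝ), EuclideanSpace.single i (1 : ℝ), (0 : ℝ))) p
      ((0 : ℝ), EuclideanSpace.single i (1 : ℝ), (0 : ℝ))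

/-- The mollifier `η^ε(x,y,z) := ε^{−2} δ^{1−N} η(x/ε) η(z/ε) ∏_{n} η(y_n/δ)`. -/
def mollifier (N : ℕ) (η : ℝ → ℝ) (ε δ : ℝ) (q : ℝ × Euc N × ℝ) : ℝ :=
  (ε ^ 2)⁻¹ * δ ^ ((1 : ℤ) - (N : ℤ)) *
    (η (q.1 / ε) * η (q.2.2 / ε) * ∏ i : Fin (N - 1), η (q.2.1 i / δ))

/-- `v^ε := v * η^ε`, the convolution (in all `N+1` variables) of `v(x,y,z) = e^z u(x,y)`
with the mollifier `η^ε`. -/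
def mollifiedV (N : ℕ) (u : ℝ × Euc N → ℝ) (η : ℝ → ℝ) (ε δ : ℝ)
    (p : ℝ × Euc N × ℝ) : ℝ :=
  ∫ q : ℝ × Euc N × ℝ, (Real.exp q.2.2 * u (q.1, q.2.1)) * mollifier N η ε δ (p - q)

open scoped Convolution in
/-- The directional derivative of a convolution falls on the smooth factor. -/
lemma fderiv_integral_mul_sub {E : Type*} [NormedAddCommGroup E] [NormedSpace ℝ E]
    [FiniteDimensional ℝ E] [MeasurableSpace E] [BorelSpace E] {μ : Measure E}
    [μ.IsAddHaarMeasure] {f g : E → ℝ}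
    (hf : LocallyIntegrable f μ) (hg : ContDiff ℝ 1 g) (hcg : HasCompactSupport g) (r v : E) :
    fderiv ℝ (fun r => ∫ q, f q * g (r - q) ∂μ) r v = ∫ q, f q * fderiv ℝ g (r - q) v ∂μ := by
  have h := (hcg.hasFDerivAt_convolution_right (ContinuousLinearMap.mul ℝ ℝ) hf hg r).fderiv
  have h2 : (fun r => ∫ q, f q * g (r - q) ∂μ) = f ⋆[ContinuousLinearMap.mul ℝ ℝ, μ] g := rfl
  rw [h2, h, convolution_precompR_apply _ hf (hcg.fderiv ℝ) (hg.continuous_fderiv one_ne_zero)]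
  rfl

open scoped Convolution in
lemma contDiff_integral_mul_sub {E : Type*} [NormedAddCommGroup E] [NormedSpace ℝ E]
    [FiniteDimensional ℝ E] [MeasurableSpace E] [BorelSpace E] {μ : Measure E}
    [μ.IsAddHaarMeasure] {f g : E → ℝ} (hf : LocallyIntegrable f μ)
    (hg : ContDiff ℝ (⊤ : ℕ∞) g) (hcg : HasCompactSupport g) :
    ContDiff ℝ (⊤ : ℕ∞) (fun r => ∫ q, f q * g (r - q) ∂μ) :=
  hcg.contDiff_convolution_right (ContinuousLinearMap.mul ℝ ℝ) hf hg

lemma integrable_mul_sub {E : Type*} [NormedAddCommGroup E] [NormedSpace ℝ E]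
    [FiniteDimensional ℝ E] [MeasurableSpace E] [BorelSpace E] {μ : Measure E}
    [μ.IsAddHaarMeasure] {f g : E → ℝ} (hf : LocallyIntegrable f μ)
    (hg : Continuous g) (hcg : HasCompactSupport g) (r : E) :
    Integrable (fun q => f q * g (r - q)) μ :=
  hcg.convolutionExists_right (ContinuousLinearMap.mul ℝ ℝ) hf hg r

lemma fderiv_comp_const_sub_apply {E : Type*} [NormedAddCommGroup E] [NormedSpace ℝ E]
    {g : E → ℝ} (hg : Differentiable ℝ g) (r q v : E) :
    fderiv ℝ (fun q => g (r - q)) q v = -fderiv ℝ g (r - q) v := by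
  have h : HasFDerivAt (fun q => r - q) (-ContinuousLinearMap.id ℝ E) q :=
    (hasFDerivAt_id q).const_sub r
  have h' : HasFDerivAt (fun q => g (r - q)) _ q := (hg (r - q)).hasFDerivAt.comp q h
  rw [h'.fderiv]
  simp

section Derivatives

instance isAddHaarMeasure_volume_prod_euc (N : ℕ) :
    (volume : Measure (ℝ × Euc N)).IsAddHaarMeasure :=
  inferInstanceAs ((volume : Measure ℝ).prod (volume : Measure (Euc N))).IsAddHaarMeasure

variable {N : ℕ} {f g : ℝ × Euc N → ℝ}

lemma ContDiff.fderiv_apply_const {E : Type*} [NormedAddCommGroup E] [NormedSpace ℝ E]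
    {g : E → ℝ} (hg : ContDiff ℝ (⊤ : ℕ∞) g) (v : E) :
    ContDiff ℝ (⊤ : ℕ∞) (fun r => fderiv ℝ g r v) :=
  (hg.fderiv_right (m := (⊤ : ℕ∞)) (by norm_cast)).clm_apply contDiff_const

lemma contDiff_lapY (hg : ContDiff ℝ (⊤ : ℕ∞) g) : ContDiff ℝ (⊤ : ℕ∞) (lapY g) :=
  ContDiff.sum fun _ _ => (hg.fderiv_apply_const _).fderiv_apply_const _

lemma hasCompactSupport_lapY (hcg : HasCompactSupport g) : HasCompactSupport (lapY g) := by
  refine HasCompactSupport.intro hcg fun x hx => Finset.sum_eq_zero fun i _ => ?_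
  set e : ℝ × Euc N := (0, EuclideanSpace.single i 1)
  by_contra hne
  have h1 : x ∈ tsupport (fun q => fderiv ℝ (fun q => fderiv ℝ g q e) q e) :=
    subset_tsupport _ hne
  exact hx (tsupport_fderiv_apply_subset ℝ e (tsupport_fderiv_apply_subset ℝ e h1))

lemma lapY_comp_const_sub (hg : ContDiff ℝ (⊤ : ℕ∞) g) (r q : ℝ × Euc N) :
    lapY (fun q => g (r - q)) q = lapY g (r - q) := by
  refine Finset.sum_congr rfl fun i _ => ?_
  simp_rw [fderiv_comp_const_sub_apply (hg.differentiable (by simp))]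
  rw [fderiv_fun_neg, neg_apply,
    fderiv_comp_const_sub_apply ((hg.fderiv_apply_const _).differentiable (by simp)), neg_neg]

lemma dX_comp_const_sub (hg : ContDiff ℝ (⊤ : ℕ∞) g) (r q : ℝ × Euc N) :
    dX (fun q => g (r - q)) q = -dX g (r - q) :=
  fderiv_comp_const_sub_apply (hg.differentiable (by simp)) _ _ _

lemma dX_integral_mul_sub (hf : LocallyIntegrable f) (hg : ContDiff ℝ (⊤ : ℕ∞) g)
    (hcg : HasCompactSupport g) (r : ℝ × Euc N) :
    dX (fun r => ∫ q, f q * g (r - q)) r = ∫ q, f q * dX g (r - q) :=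
  fderiv_integral_mul_sub hf (hg.of_le (by norm_cast)) hcg _ _

lemma lapY_integral_mul_sub (hf : LocallyIntegrable f) (hg : ContDiff ℝ (⊤ : ℕ∞) g)
    (hcg : HasCompactSupport g) (r : ℝ × Euc N) :
    lapY (fun r => ∫ q, f q * g (r - q)) r = ∫ q, f q * lapY g (r - q) := by
  have hone {h : ℝ × Euc N → ℝ} (hh : ContDiff ℝ (⊤ : ℕ∞) h) : ContDiff ℝ 1 h :=
    hh.of_le (by norm_cast)
  simp only [lapY, Finset.mul_sum]
  rw [integral_finsetSum]
  · refine Finset.sum_congr rfl fun i _ => ?_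
    simp_rw [fderiv_integral_mul_sub hf (hone hg) hcg]
    exact fderiv_integral_mul_sub hf (hone (hg.fderiv_apply_const _)) (hcg.fderiv_apply ℝ _) _ _
  · intro i _
    exact integrable_mul_sub hf ((hg.fderiv_apply_const _).fderiv_apply_const _).continuous
      ((hcg.fderiv_apply ℝ _).fderiv_apply ℝ _) r

/-- The derivative of a function of the form `C e^z h(x,y)`. -/
lemma fderiv_exp_mul {h : ℝ × Euc N → ℝ} (hh : Differentiable ℝ h) (C : ℝ)
    (p : ℝ × Euc N × ℝ) (a : ℝ) (b : Euc N) (c : ℝ) :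
    fderiv ℝ (fun p : ℝ × Euc N × ℝ => C * Real.exp p.2.2 * h (p.1, p.2.1)) p (a, b, c) =
      C * Real.exp p.2.2 * (fderiv ℝ h (p.1, p.2.1) (a, b) + c * h (p.1, p.2.1)) := by
  have h1 : HasFDerivAt (fun p : ℝ × Euc N × ℝ => p.2.2) _ p :=
    ((ContinuousLinearMap.snd ℝ (Euc N) ℝ).comp
      (ContinuousLinearMap.snd ℝ ℝ (Euc N × ℝ))).hasFDerivAt
  have h2 : HasFDerivAt (fun p : ℝ × Euc N × ℝ => (p.1, p.2.1)) _ p :=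
    ((ContinuousLinearMap.fst ℝ ℝ (Euc N × ℝ)).prod
      ((ContinuousLinearMap.fst ℝ (Euc N) ℝ).comp
        (ContinuousLinearMap.snd ℝ ℝ (Euc N × ℝ)))).hasFDerivAt
  have h3 := (h1.exp.const_mul C).mul ((hh (p.1, p.2.1)).hasFDerivAt.comp p h2)
  erw [h3.fderiv]
  simp
  ring

end Derivatives

section Kernel

/-- The factor of the mollifier in the variables `(x,y)`. -/
def spaceKernel (N : ℕ) (η : ℝ → ℝ) (ε δ : ℝ) (r : ℝ × Euc N) : ℝ :=
  ε⁻¹ * δ ^ ((1 : ℤ) - (N : ℤ)) * (η (r.1 / ε) * ∏ i : Fin (N - 1), η (r.2 i / δ))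

variable {N : ℕ} {η : ℝ → ℝ} {ε δ : ℝ}

lemma mollifier_eq_mul (q : ℝ × Euc N × ℝ) :
    mollifier N η ε δ q = spaceKernel N η ε δ (q.1, q.2.1) * (ε⁻¹ * η (q.2.2 / ε)) := by
  simp only [mollifier, spaceKernel]
  ring

lemma contDiff_spaceKernel (hη : ContDiff ℝ (⊤ : ℕ∞) η) :
    ContDiff ℝ (⊤ : ℕ∞) (spaceKernel N η ε δ) := by
  unfold spaceKernel
  refine contDiff_const.mul ((hη.comp (contDiff_fst.div_const _)).mul ?_)
  refine contDiff_prod fun i _ => hη.comp (ContDiff.div_const ?_ _)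
  exact (EuclideanSpace.proj (𝕜 := ℝ) i).contDiff.comp contDiff_snd

lemma spaceKernel_nonneg (hη : ∀ x, 0 ≤ η x) (hε : 0 ≤ ε) (hδ : 0 ≤ δ) (r : ℝ × Euc N) :
    0 ≤ spaceKernel N η ε δ r :=
  mul_nonneg (mul_nonneg (inv_nonneg.2 hε) (zpow_nonneg hδ _))
    (mul_nonneg (hη _) (Finset.prod_nonneg fun _ _ => hη _))

lemma support_spaceKernel_subset (hN : 1 ≤ N) (hη : Function.support η ⊆ Icc (-1 : ℝ) 1)
    (hε : 0 < ε) (hδ : 0 < δ) :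
    Function.support (spaceKernel N η ε δ) ⊆
      closedBall 0 ε ×ˢ closedBall 0 (Real.sqrt ((N : ℝ) - 1) * δ) := by
  intro r hr
  have hr' := right_ne_zero_of_mul hr
  have habs {t c : ℝ} (hc : 0 < c) (h : η (t / c) ≠ 0) : |t| ≤ c := by
    have h1 := abs_le.2 (hη h)
    rwa [abs_div, abs_of_pos hc, div_le_one hc] at h1
  refine ⟨by simpa using habs hε (left_ne_zero_of_mul hr'), ?_⟩
  have hprod := Finset.prod_ne_zero_iff.1 (right_ne_zero_of_mul hr')
  have hcard : ((N - 1 : ℕ) : ℝ) = (N : ℝ) - 1 := by push_cast [hN]; ring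
  rw [mem_closedBall_zero_iff, EuclideanSpace.norm_eq, ← Real.sqrt_sq hδ.le,
    ← Real.sqrt_mul (hcard ▸ Nat.cast_nonneg _)]
  refine Real.sqrt_le_sqrt ?_
  calc ∑ i, ‖r.2 i‖ ^ 2 ≤ ∑ _i : Fin (N - 1), δ ^ 2 :=
        Finset.sum_le_sum fun i hi => pow_le_pow_left₀ (norm_nonneg _) (habs hδ (hprod i hi)) 2
    _ = ((N : ℝ) - 1) * δ ^ 2 := by simp [hcard]

lemma tsupport_spaceKernel_subset (hN : 1 ≤ N) (hη : Function.support η ⊆ Icc (-1 : ℝ) 1)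
    (hε : 0 < ε) (hδ : 0 < δ) :
    tsupport (spaceKernel N η ε δ) ⊆
      closedBall 0 ε ×ˢ closedBall 0 (Real.sqrt ((N : ℝ) - 1) * δ) :=
  closure_minimal (support_spaceKernel_subset hN hη hε hδ)
    (isClosed_closedBall.prod isClosed_closedBall)

lemma hasCompactSupport_spaceKernel (hN : 1 ≤ N) (hη : Function.support η ⊆ Icc (-1 : ℝ) 1)
    (hε : 0 < ε) (hδ : 0 < δ) : HasCompactSupport (spaceKernel N η ε δ) :=
  ((isCompact_closedBall _ _).prod (isCompact_closedBall _ _)).of_isClosed_subset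
    (isClosed_tsupport _) (tsupport_spaceKernel_subset hN hη hε hδ)

lemma dX_spaceKernel (hη : Differentiable ℝ η) (r : ℝ × Euc N) :
    dX (spaceKernel N η ε δ) r =
      ε⁻¹ * (ε⁻¹ * deriv η (r.1 / ε)) *
        (δ ^ ((1 : ℤ) - (N : ℤ)) * ∏ i : Fin (N - 1), η (r.2 i / δ)) := by
  have hdiff : DifferentiableAt ℝ (spaceKernel N η ε δ) r := by
    unfold spaceKernel
    fun_prop
  have hline : HasDerivAt (fun t : ℝ => (t, r.2)) ((1 : ℝ), (0 : Euc N)) r.1 :=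
    (hasDerivAt_id r.1).prodMk (hasDerivAt_const r.1 r.2)
  have h1 : HasDerivAt (fun t => spaceKernel N η ε δ (t, r.2)) (dX (spaceKernel N η ε δ) r) r.1 :=
    HasFDerivAt.comp_hasDerivAt (f := fun t : ℝ => (t, r.2)) r.1 hdiff.hasFDerivAt hline
  have h2 : HasDerivAt (fun t => η (t / ε)) (deriv η (r.1 / ε) * (1 / ε)) r.1 :=
    (hη (r.1 / ε)).hasDerivAt.comp r.1 ((hasDerivAt_id r.1).div_const ε)
  rw [h1.unique ((h2.mul_const (∏ i : Fin (N - 1), η (r.2 i / δ))).const_mul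
    (ε⁻¹ * δ ^ ((1 : ℤ) - (N : ℤ))))]
  ring

lemma integral_eq_one_of_support_subset (hηsupp : Function.support η ⊆ Icc (-1 : ℝ) 1)
    (hηint : (∫ x in (-1 : ℝ)..1, η x) = 1) : ∫ x, η x = 1 := by
  rw [← hηint, intervalIntegral.integral_of_le (by norm_num), ← integral_Icc_eq_integral_Ioc,
    setIntegral_eq_integral_of_forall_compl_eq_zero]
  exact fun x hx => Function.notMem_support.1 fun h => hx (hηsupp h)

lemma integral_abs_deriv_le (hηsupp : Function.support η ⊆ Icc (-1 : ℝ) 1)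
    (hηderiv : ∀ x, |deriv η x| ≤ 2) : ∫ x, |deriv η x| ≤ 4 := by
  have hsupp : ∀ x ∉ Icc (-1 : ℝ) 1, |deriv η x| = 0 := fun x hx => by
    rw [abs_eq_zero]
    by_contra h
    exact hx (closure_minimal hηsupp isClosed_Icc (support_deriv_subset h))
  rw [← setIntegral_eq_integral_of_forall_compl_eq_zero hsupp]
  have h := norm_setIntegral_le_of_norm_le_const (μ := volume) (s := Icc (-1 : ℝ) 1)
    (f := fun x => |deriv η x|) (C := 2) (by simp) fun x _ => by simpa using hηderiv x
  rw [Real.volume_real_Icc] at h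
  norm_num at h
  exact (le_abs_self _).trans h

lemma integral_prod_comp_div (hN : 1 ≤ N) (hδ : 0 < δ) (hη : ∫ x, η x = 1) :
    ∫ y : Euc N, δ ^ ((1 : ℤ) - (N : ℤ)) * ∏ i : Fin (N - 1), η (y i / δ) = 1 := by
  have h := (PiLp.volume_preserving_toLp (Fin (N - 1))).integral_comp
    (MeasurableEquiv.toLp 2 (Fin (N - 1) → ℝ)).measurableEmbedding
    (fun y : Euc N => ∏ i : Fin (N - 1), η (y i / δ))
  rw [integral_const_mul, ← h]
  simp only
  rw [integral_fintype_prod_volume_eq_pow (fun x => η (x / δ)), Measure.integral_comp_div, hη,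
    Fintype.card_fin, abs_of_pos hδ, smul_eq_mul, mul_one, ← zpow_natCast, ← zpow_add₀ hδ.ne']
  push_cast [hN]
  simp

lemma integral_abs_dX_spaceKernel_le (hN : 1 ≤ N) (hη : Differentiable ℝ η) (hη0 : ∀ x, 0 ≤ η x)
    (hηsupp : Function.support η ⊆ Icc (-1 : ℝ) 1)
    (hηint : (∫ x in (-1 : ℝ)..1, η x) = 1) (hηderiv : ∀ x, |deriv η x| ≤ 2)
    (hε : 0 < ε) (hδ : 0 < δ) :
    ∫ r, |dX (spaceKernel N η ε δ) r| ≤ 4 / ε := by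
  have h1 (r : ℝ × Euc N) : |dX (spaceKernel N η ε δ) r| =
      (ε⁻¹ * ε⁻¹ * |deriv η (r.1 / ε)|) *
        (δ ^ ((1 : ℤ) - (N : ℤ)) * ∏ i : Fin (N - 1), η (r.2 i / δ)) := by
    have h0 : 0 ≤ δ ^ ((1 : ℤ) - (N : ℤ)) * ∏ i : Fin (N - 1), η (r.2 i / δ) :=
      mul_nonneg (zpow_nonneg hδ.le _) (Finset.prod_nonneg fun _ _ => hη0 _)
    rw [dX_spaceKernel hη, abs_mul, abs_of_nonneg h0, abs_mul, abs_mul,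
      abs_of_pos (inv_pos.2 hε), mul_assoc ε⁻¹ ε⁻¹]
  simp_rw [h1]
  rw [Measure.volume_eq_prod, integral_prod_mul (fun x => ε⁻¹ * ε⁻¹ * |deriv η (x / ε)|)
    (fun y : Euc N => δ ^ ((1 : ℤ) - (N : ℤ)) * ∏ i : Fin (N - 1), η (y i / δ)),
    integral_prod_comp_div hN hδ (integral_eq_one_of_support_subset hηsupp hηint), mul_one,
    integral_const_mul, Measure.integral_comp_div (fun x => |deriv η x|), abs_of_pos hε,
    smul_eq_mul]
  have h4 := integral_abs_deriv_le hηsupp hηderiv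
  calc ε⁻¹ * ε⁻¹ * (ε * ∫ x, |deriv η x|) = (∫ x, |deriv η x|) / ε := by field_simp
    _ ≤ 4 / ε := by gcongr

/-- The constant `∫ e^{-εs} η(s) ds` by which mollification multiplies `e^z`. -/
lemma integral_exp_mul_kernel (hε : 0 < ε) (z : ℝ) :
    ∫ t, Real.exp t * (ε⁻¹ * η ((z - t) / ε)) =
      (∫ s, Real.exp (-(ε * s)) * η s) * Real.exp z := by
  have h := integral_sub_left_eq_self
    (fun t => Real.exp (z - t) * (ε⁻¹ * η (t / ε))) volume z
  simp only [sub_sub_cancel] at h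
  rw [h]
  have h2 (t : ℝ) : Real.exp (z - t) * (ε⁻¹ * η (t / ε)) =
      (fun s => Real.exp (z - ε * s) * (ε⁻¹ * η s)) (t / ε) := by
    simp only
    rw [mul_div_cancel₀ _ hε.ne']
  simp_rw [h2]
  rw [Measure.integral_comp_div (fun s => Real.exp (z - ε * s) * (ε⁻¹ * η s)),
    abs_of_pos hε, smul_eq_mul, ← integral_const_mul,
    ← integral_mul_const]
  refine integral_congr_ae (.of_forall fun s => ?_)
  simp only [sub_eq_add_neg, Real.exp_add]
  field_simp

lemma integral_exp_mul_le (hηcont : Continuous η) (hη0 : ∀ x, 0 ≤ η x)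
    (hηsupp : Function.support η ⊆ Icc (-1 : ℝ) 1)
    (hηint : (∫ x in (-1 : ℝ)..1, η x) = 1) (hε : 0 < ε) :
    ∫ s, Real.exp (-(ε * s)) * η s ≤ Real.exp ε := by
  have hcs : HasCompactSupport η :=
    isCompact_Icc.of_isClosed_subset (isClosed_tsupport _) (closure_minimal hηsupp isClosed_Icc)
  calc ∫ s, Real.exp (-(ε * s)) * η s ≤ ∫ s, Real.exp ε * η s := by
        refine integral_mono ?_ ((hηcont.integrable_of_hasCompactSupport hcs).const_mul _) ?_
        · exact Continuous.integrable_of_hasCompactSupport (by fun_prop) hcs.mul_left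
        · intro s
          by_cases hs : η s = 0
          · simp [hs]
          · have := (hηsupp hs).1
            have : Real.exp (-(ε * s)) ≤ Real.exp ε := Real.exp_le_exp.2 (by nlinarith)
            exact mul_le_mul_of_nonneg_right this (hη0 s)
    _ = Real.exp ε := by
        rw [integral_const_mul, integral_eq_one_of_support_subset hηsupp hηint, mul_one]

/-- The mollification of `e^z u(x,y)` factorizes. -/
lemma mollifiedV_eq (u : ℝ × Euc N → ℝ) (hε : 0 < ε) (p : ℝ × Euc N × ℝ) :
    mollifiedV N u η ε δ p = (∫ s, Real.exp (-(ε * s)) * η s) * Real.exp p.2.2 *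
      ∫ q, u q * spaceKernel N η ε δ ((p.1, p.2.1) - q) := by
  have h := (volume_preserving_prodAssoc (α₁ := ℝ) (β₁ := Euc N) (γ₁ := ℝ)).integral_comp
    MeasurableEquiv.prodAssoc.measurableEmbedding
    (fun q : ℝ × Euc N × ℝ => (Real.exp q.2.2 * u (q.1, q.2.1)) * mollifier N η ε δ (p - q))
  rw [mollifiedV, ← h, ← integral_exp_mul_kernel hε, mul_comm,
    ← integral_prod_mul, ← Measure.volume_eq_prod]
  refine integral_congr_ae (.of_forall fun q => ?_)
  simp only [mollifier_eq_mul, MeasurableEquiv.prodAssoc, MeasurableEquiv.coe_mk,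
    Equiv.prodAssoc_apply, Prod.fst_sub, Prod.snd_sub]
  rw [show ((p.1, p.2.1) : ℝ × Euc N) - q.1 = (p.1 - q.1.1, p.2.1 - q.1.2) from rfl]
  ring

end Kernel

section Estimate

variable {N : ℕ}

lemma measurableSet_cylD : MeasurableSet (cylD N) := (isOpen_Ioo.prod isOpen_ball).measurableSet

lemma volume_cylD_ne_top : volume (cylD N) ≠ ⊤ :=
  ((isBounded_Ioo _ _).prod isBounded_ball).measure_lt_top.ne

lemma locallyIntegrable_indicator_cylD {u : ℝ × Euc N → ℝ} {K : ℝ}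
    (hucont : ContinuousOn u (cylD N)) (hK : ∀ p ∈ cylD N, |u p| ≤ K) :
    LocallyIntegrable ((cylD N).indicator u) := by
  refine Integrable.locallyIntegrable ((integrable_indicator_iff measurableSet_cylD).2 ?_)
  exact IntegrableOn.of_bound volume_cylD_ne_top.lt_top
    (hucont.aestronglyMeasurable measurableSet_cylD) K
    (ae_restrict_of_forall_mem measurableSet_cylD hK)

/-- If `k` is a nonnegative test kernel such that `β` oscillates by at most `c` on the support of
`k (r - ·)`, mollifying a bounded nonnegative solution `u` by `k` gives
`(Δ_y + β(y) ∂_x + 1) (u * k) ≥ -K c ‖k_x‖₁` at `r`, where `K` bounds `u`. -/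
lemma le_lapY_add_dX_add_self {β : Euc N → ℝ} (hβcont : ContinuousOn β (ball (0 : Euc N) 3))
    {M : ℝ} (hβbdd : ∀ y ∈ ball (0 : Euc N) 3, |β y| ≤ M)
    {γ : ℝ × Euc N → ℝ} (hγmeas : Measurable γ)
    (hγbdd : ∀ᵐ p ∂(volume.restrict (cylD N)), |γ p| ≤ 1)
    {u : ℝ × Euc N → ℝ} (hucont : ContinuousOn u (cylD N))
    (hupos : ∀ p ∈ cylD N, 0 ≤ u p) {K : ℝ} (hK : ∀ p ∈ cylD N, u p ≤ K)
    (husol : IsDistribSolution (cylD N) β γ u)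
    {k : ℝ × Euc N → ℝ} (hk : ContDiff ℝ (⊤ : ℕ∞) k) (hck : HasCompactSupport k)
    (hk0 : ∀ r, 0 ≤ k r) {r : ℝ × Euc N} {c : ℝ}
    (hr : ∀ q, r - q ∈ tsupport k → q ∈ cylD N)
    (hβr : ∀ q, r - q ∈ tsupport k → |β r.2 - β q.2| ≤ c) :
    -(K * c * ∫ q, |dX k q|) ≤
      lapY (fun r => ∫ q, (cylD N).indicator u q * k (r - q)) r
        + β r.2 * dX (fun r => ∫ q, (cylD N).indicator u q * k (r - q)) r
        + ∫ q, (cylD N).indicator u q * k (r - q) := by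
  set f := (cylD N).indicator u with hfdef
  have hf : LocallyIntegrable f := locallyIntegrable_indicator_cylD hucont
    fun p hp => by rw [abs_of_nonneg (hupos p hp)]; exact hK p hp
  have hdk : ContDiff ℝ (⊤ : ℕ∞) (dX k) := hk.fderiv_apply_const _
  have hcdk : HasCompactSupport (dX k) := hck.fderiv_apply ℝ _
  rw [lapY_integral_mul_sub hf hk hck, dX_integral_mul_sub hf hk hck]
  have hA := integrable_mul_sub hf (contDiff_lapY hk).continuous (hasCompactSupport_lapY hck) r
  have hB := integrable_mul_sub hf hdk.continuous hcdk r
  have hD := integrable_mul_sub hf hk.continuous hck r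
  have hS := measurableSet_cylD (N := N)
  have hβS : ContinuousOn (fun q : ℝ × Euc N => β q.2) (cylD N) :=
    hβcont.comp continuousOn_snd fun q hq => hq.2
  have hBβ : IntegrableOn (fun q => β q.2 * (f q * dX k (r - q))) (cylD N) :=
    hB.integrableOn.bdd_mul (hβS.aestronglyMeasurable hS)
      (ae_restrict_of_forall_mem hS fun q hq => hβbdd q.2 hq.2)
  have hDγ : IntegrableOn (fun q => γ q * (f q * k (r - q))) (cylD N) :=
    hD.integrableOn.bdd_mul hγmeas.aestronglyMeasurable hγbdd
  -- the equation tested against `k (r - ·)`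
  have hzero : ∫ q in cylD N, (f q * lapY k (r - q) + β q.2 * (f q * dX k (r - q))
      + γ q * (f q * k (r - q))) = 0 := by
    have hts : tsupport (fun q => k (r - q)) ⊆ (fun q => r - q) ⁻¹' tsupport k :=
      closure_minimal (fun q hq => subset_tsupport _ hq)
        ((isClosed_tsupport k).preimage (by fun_prop))
    rw [← husol (fun q => k (r - q)) (hk.comp (contDiff_const.sub contDiff_id))
      (hck.comp_homeomorph (Homeomorph.subLeft r)) fun q hq => hr q (hts hq)]
    refine setIntegral_congr_fun hS fun q hq => ?_
    simp only [lapY_comp_const_sub hk, dX_comp_const_sub hk, hfdef, indicator_of_mem hq]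
    ring
  have hrestrict (g : ℝ × Euc N → ℝ) : ∫ q, f q * g q = ∫ q in cylD N, f q * g q :=
    (setIntegral_eq_integral_of_forall_compl_eq_zero fun q hq => by
      simp [hfdef, indicator_of_notMem hq]).symm
  have hBc : IntegrableOn (fun q => β r.2 * (f q * dX k (r - q))) (cylD N) :=
    hB.integrableOn.const_mul _
  have hABc : IntegrableOn (fun q => f q * lapY k (r - q) + β r.2 * (f q * dX k (r - q)))
      (cylD N) := hA.integrableOn.add hBc
  have hsum : IntegrableOn (fun q => f q * lapY k (r - q) + β r.2 * (f q * dX k (r - q))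
      + f q * k (r - q)) (cylD N) := hABc.add hD.integrableOn
  have hsum0 : IntegrableOn (fun q => f q * lapY k (r - q) + β q.2 * (f q * dX k (r - q))
      + γ q * (f q * k (r - q))) (cylD N) := (hA.integrableOn.add hBβ).add hDγ
  rw [hrestrict fun q => lapY k (r - q), hrestrict fun q => dX k (r - q),
    hrestrict fun q => k (r - q), ← integral_const_mul (β r.2),
    ← integral_add hA.integrableOn hBc,
    ← integral_add hABc hD.integrableOn, ← sub_zero (∫ q in cylD N, _), ← hzero,
    ← integral_sub hsum hsum0]
  have habs : Integrable (fun q => |dX k (r - q)|) :=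
    (hdk.continuous.integrable_of_hasCompactSupport hcdk).abs.comp_sub_left r
  have hKc : 0 ≤ K * c ∨ ∀ q, dX k q = 0 := by
    by_cases h : ∃ q, dX k q ≠ 0
    · obtain ⟨q, hq⟩ := h
      have hq' : r - (r - q) ∈ tsupport k := by
        rw [sub_sub_cancel]
        exact tsupport_fderiv_apply_subset ℝ _ (subset_tsupport _ hq)
      have hm := hr _ hq'
      exact .inl (mul_nonneg ((hupos _ hm).trans (hK _ hm)) ((abs_nonneg _).trans (hβr _ hq')))
    · exact .inr fun q => by_contra fun hq => h ⟨q, hq⟩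
  calc -(K * c * ∫ q, |dX k q|) = -∫ q, K * c * |dX k (r - q)| := by
        rw [integral_const_mul, integral_sub_left_eq_self (fun q => |dX k q|) volume r]
    _ ≤ -∫ q in cylD N, K * c * |dX k (r - q)| := by
        refine neg_le_neg (setIntegral_le_integral (habs.const_mul _) (.of_forall fun q => ?_))
        rcases hKc with h | h
        · exact mul_nonneg h (abs_nonneg _)
        · simp [h]
    _ = ∫ q in cylD N, -(K * c * |dX k (r - q)|) := (integral_neg _).symm
    _ ≤ _ := by
        refine integral_mono_ae (habs.const_mul _).neg.integrableOn
          (hsum.sub hsum0) ?_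
        filter_upwards [hγbdd, ae_restrict_mem hS] with q hγq hq
        have hfq : f q = u q := indicator_of_mem hq u
        have hu0 := hupos q hq
        have hβq : -(K * c * |dX k (r - q)|) ≤ u q * ((β r.2 - β q.2) * dX k (r - q)) := by
          by_cases hd : dX k (r - q) = 0
          · simp [hd]
          have hts : r - q ∈ tsupport k :=
            tsupport_fderiv_apply_subset ℝ _ (subset_tsupport _ hd)
          refine neg_le_of_abs_le ?_
          rw [abs_mul, abs_mul, abs_of_nonneg hu0, ← mul_assoc]
          gcongr
          · exact (hu0.trans (hK q hq))
          · exact hK q hq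
          · exact hβr q hts
        have hγk : 0 ≤ u q * ((1 - γ q) * k (r - q)) :=
          mul_nonneg hu0 (mul_nonneg (by linarith [(abs_le.1 hγq).2]) (hk0 _))
        simp only [hfq]
        linarith

/-- The operator `Δ_y + β ∂_x + ∂_z` applied to a function that is locally `C e^z h(x,y)`. -/
lemma lapY3_add_dX3_add_dZ3_of_eventuallyEq {F : ℝ × Euc N × ℝ → ℝ} {h : ℝ × Euc N → ℝ} {C : ℝ}
    (hh : ContDiff ℝ (⊤ : ℕ∞) h) {p : ℝ × Euc N × ℝ}
    (hF : F =ᶠ[nhds p] fun p => C * Real.exp p.2.2 * h (p.1, p.2.1)) (b : ℝ) :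
    lapY3 F p + b * dX3 F p + dZ3 F p = C * Real.exp p.2.2 *
      (lapY h (p.1, p.2.1) + b * dX h (p.1, p.2.1) + h (p.1, p.2.1)) := by
  have hd : Differentiable ℝ h := hh.differentiable (by simp)
  have hlap : lapY3 F p = C * Real.exp p.2.2 * lapY h (p.1, p.2.1) := by
    rw [lapY3, lapY, Finset.mul_sum]
    refine Finset.sum_congr rfl fun i _ => ?_
    have h1 : (fun q => fderiv ℝ F q ((0 : ℝ), EuclideanSpace.single i (1 : ℝ), (0 : ℝ)))
        =ᶠ[nhds p] fun q => C * Real.exp q.2.2 *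
          fderiv ℝ h (q.1, q.2.1) ((0 : ℝ), EuclideanSpace.single i (1 : ℝ)) := by
      filter_upwards [hF.fderiv (𝕜 := ℝ)] with q hq
      rw [hq, fderiv_exp_mul hd]
      simp
    rw [h1.fderiv_eq, fderiv_exp_mul ((hh.fderiv_apply_const _).differentiable (by simp))]
    simp
  rw [hlap, dX3, dZ3, hF.fderiv_eq, fderiv_exp_mul hd, fderiv_exp_mul hd, dX]
  rw [show ((0 : ℝ), (0 : Euc N)) = 0 from rfl, map_zero]
  ring

end Estimate

/-- **Mollification estimate.**  In the normalized setting, with `v(x,y,z) = e^z u(x,y)` and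
`v^ε = v * η^ε` as above, for every `(x,y,z) ∈ (−4,5)×B_2(0)×ℝ` one has
`Δ_y v^ε + β(y) ∂_x v^ε + ∂_z v^ε ≥ −2^{N+2} ε e^{z+ε} ‖u‖_∞`. -/
theorem mollification_estimate
    (N : ℕ) (hN : 2 ≤ N)
    (β : Euc N → ℝ) (hβsmooth : ContDiffOn ℝ (⊤ : ℕ∞) β (ball (0 : Euc N) 3))
    (hβbdd : ∀ k : ℕ, ∃ M : ℝ, ∀ y ∈ ball (0 : Euc N) 3,
      ‖iteratedFDerivWithin ℝ k β (ball (0 : Euc N) 3) y‖ ≤ M)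
    (hβneg : ∃ y ∈ ball (0 : Euc N) 1, β y < 0)
    (hβpos : ∃ y ∈ ball (0 : Euc N) 1, 0 < β y)
    (γ : ℝ × Euc N → ℝ) (hγmeas : Measurable γ)
    (hγbdd : ∀ᵐ p ∂(volume.restrict (cylD N)), |γ p| ≤ 1)
    (u : ℝ × Euc N → ℝ) (hucont : ContinuousOn u (cylD N))
    (hupos : ∀ p ∈ cylD N, 0 ≤ u p)
    (hubdd : ∃ K : ℝ, ∀ p ∈ cylD N, u p ≤ K)
    (husol : IsDistribSolution (cylD N) β γ u)
    (η : ℝ → ℝ) (hηsmooth : ContDiff ℝ (⊤ : ℕ∞) η) (hηrange : ∀ x, η x ∈ Icc (0 : ℝ) 1)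
    (hηsupp : Function.support η ⊆ Icc (-1 : ℝ) 1)
    (hηint : (∫ x in (-1 : ℝ)..1, η x) = 1)
    (hηderiv : ∀ x, |deriv η x| ≤ 2)
    (ε : ℝ) (hε : ε ∈ Ioo (0 : ℝ) 1)
    (δ : ℝ) (hδ : δ ∈ Ioo (0 : ℝ) (1 / (2 * Real.sqrt ((N : ℝ) - 1))))
    (hδβ : ∀ y ∈ ball (0 : Euc N) (5 / 2), ∀ y' ∈ ball (0 : Euc N) (5 / 2),
      dist y y' ≤ Real.sqrt ((N : ℝ) - 1) * δ → |β y - β y'| ≤ ε ^ 2) :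
    ∀ p : ℝ × Euc N × ℝ, p.1 ∈ Ioo (-4 : ℝ) 5 → p.2.1 ∈ ball (0 : Euc N) 2 →
      -(2 ^ (N + 2) * ε * Real.exp (p.2.2 + ε) * sSup (u '' cylD N))
        ≤ lapY3 (mollifiedV N u η ε δ) p + β p.2.1 * dX3 (mollifiedV N u η ε δ) p
          + dZ3 (mollifiedV N u η ε δ) p := by
  intro p hp1 hp2
  obtain ⟨hε0, hε1⟩ := hε
  obtain ⟨hδ0, hδ1⟩ := hδ
  have hN1 : 1 ≤ N := by omega
  obtain ⟨K, hK⟩ := hubdd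
  have hsup : ∀ q ∈ cylD N, u q ≤ sSup (u '' cylD N) := fun q hq =>
    le_csSup ⟨K, by rintro _ ⟨q, hq, rfl⟩; exact hK q hq⟩ (mem_image_of_mem u hq)
  have hη0 : ∀ x, 0 ≤ η x := fun x => (hηrange x).1
  have hrad : Real.sqrt ((N : ℝ) - 1) * δ < 1 / 2 := by
    have hs : 0 < Real.sqrt ((N : ℝ) - 1) := Real.sqrt_pos.2 (by
      have : (2 : ℝ) ≤ N := by exact_mod_cast hN
      linarith)
    rw [lt_div_iff₀ (by positivity)] at hδ1
    linarith
  have hts := tsupport_spaceKernel_subset (N := N) hN1 hηsupp hε0 hδ0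
  have hk := contDiff_spaceKernel (N := N) (ε := ε) (δ := δ) hηsmooth
  have hck := hasCompactSupport_spaceKernel (N := N) hN1 hηsupp hε0 hδ0
  have hball {r q : ℝ × Euc N} (hr : r.2 ∈ ball (0 : Euc N) 2)
      (hq : r - q ∈ tsupport (spaceKernel N η ε δ)) :
      q.2 ∈ ball (0 : Euc N) (5 / 2) ∧ dist r.2 q.2 ≤ Real.sqrt ((N : ℝ) - 1) * δ := by
    have h := mem_closedBall_zero_iff.1 (hts hq).2
    rw [Prod.snd_sub, ← dist_eq_norm] at h
    refine ⟨?_, h⟩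
    rw [mem_ball] at hr ⊢
    have := dist_triangle_left q.2 0 r.2
    linarith
  have hmem {r q : ℝ × Euc N} (hr1 : r.1 ∈ Ioo (-4 : ℝ) 5) (hr2 : r.2 ∈ ball (0 : Euc N) 2)
      (hq : r - q ∈ tsupport (spaceKernel N η ε δ)) : q ∈ cylD N := by
    have h := mem_closedBall_zero_iff.1 (hts hq).1
    rw [Prod.fst_sub, Real.norm_eq_abs, abs_le] at h
    exact ⟨⟨by linarith [hr1.1], by linarith [hr1.2]⟩,
      ball_subset_ball (by norm_num) (hball hr2 hq).1⟩
  obtain ⟨M, hM⟩ := hβbdd 0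
  set W : ℝ × Euc N → ℝ := fun r =>
    ∫ q, (cylD N).indicator u q * spaceKernel N η ε δ (r - q)
  have hβM : ∀ y ∈ ball (0 : Euc N) 3, |β y| ≤ M := fun y hy => by
    simpa only [norm_iteratedFDerivWithin_zero, Real.norm_eq_abs] using hM y hy
  have hosc (q : ℝ × Euc N) (hq : (p.1, p.2.1) - q ∈ tsupport (spaceKernel N η ε δ)) :
      |β p.2.1 - β q.2| ≤ ε ^ 2 :=
    have hq' := hball (r := (p.1, p.2.1)) hp2 hq
    hδβ _ (ball_subset_ball (by norm_num) hp2) _ hq'.1 hq'.2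
  have hcyl (q : ℝ × Euc N) (hq : (p.1, p.2.1) - q ∈ tsupport (spaceKernel N η ε δ)) :
      q ∈ cylD N := hmem (r := (p.1, p.2.1)) hp1 hp2 hq
  have hest := le_lapY_add_dX_add_self hβsmooth.continuousOn hβM hγmeas hγbdd hucont hupos hsup
    husol hk hck (spaceKernel_nonneg hη0 hε0.le hδ0.le) (r := (p.1, p.2.1)) hcyl hosc
  have hW : ContDiff ℝ (⊤ : ℕ∞) W := contDiff_integral_mul_sub (locallyIntegrable_indicator_cylD hucont
    fun q hq => by rw [abs_of_nonneg (hupos q hq)]; exact hsup q hq) hk hck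
  have hev : mollifiedV N u η ε δ =ᶠ[nhds p] fun p =>
      (∫ s, Real.exp (-(ε * s)) * η s) * Real.exp p.2.2 * W (p.1, p.2.1) := by
    have hopen : IsOpen {p : ℝ × Euc N × ℝ | p.1 ∈ Ioo (-4 : ℝ) 5 ∧ p.2.1 ∈ ball (0 : Euc N) 2} :=
      (isOpen_Ioo.preimage continuous_fst).inter
        (isOpen_ball.preimage (continuous_fst.comp continuous_snd))
    filter_upwards [hopen.mem_nhds ⟨hp1, hp2⟩] with p hp
    rw [mollifiedV_eq u hε0]
    congr 1
    refine integral_congr_ae (.of_forall fun q => ?_)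
    by_cases hq : spaceKernel N η ε δ ((p.1, p.2.1) - q) = 0
    · simp [hq]
    · simp only [indicator_of_mem (hmem (r := (p.1, p.2.1)) hp.1 hp.2 (subset_tsupport _ hq))]
  rw [lapY3_add_dX3_add_dZ3_of_eventuallyEq hW hev]
  have hS0 : 0 ≤ sSup (u '' cylD N) := Real.sSup_nonneg (by
    rintro _ ⟨q, hq, rfl⟩
    exact hupos q hq)
  have hC0 : 0 ≤ ∫ s, Real.exp (-(ε * s)) * η s :=
    integral_nonneg fun s => mul_nonneg (Real.exp_pos _).le (hη0 s)
  have hC1 := integral_exp_mul_le hηsmooth.continuous hη0 hηsupp hηint hε0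
  have hI := integral_abs_dX_spaceKernel_le (N := N) hN1 (hηsmooth.differentiable (by simp)) hη0
    hηsupp hηint hηderiv hε0 hδ0
  have hpow : (4 : ℝ) ≤ 2 ^ (N + 2) := by
    rw [pow_add]
    nlinarith [one_le_pow₀ (M₀ := ℝ) (a := 2) (n := N) (by norm_num)]
  have hest' : -(4 * ε * sSup (u '' cylD N)) ≤ lapY W (p.1, p.2.1)
      + β p.2.1 * dX W (p.1, p.2.1) + W (p.1, p.2.1) := le_trans (neg_le_neg (by
    calc sSup (u '' cylD N) * ε ^ 2 * ∫ q, |dX (spaceKernel N η ε δ) q|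
        ≤ sSup (u '' cylD N) * ε ^ 2 * (4 / ε) := by gcongr
      _ = 4 * ε * sSup (u '' cylD N) := by field_simp)) hest
  calc -(2 ^ (N + 2) * ε * Real.exp (p.2.2 + ε) * sSup (u '' cylD N))
      ≤ -((∫ s, Real.exp (-(ε * s)) * η s) * Real.exp p.2.2 * (4 * ε * sSup (u '' cylD N))) := by
        refine neg_le_neg ?_
        calc _ ≤ Real.exp ε * Real.exp p.2.2 * (2 ^ (N + 2) * ε * sSup (u '' cylD N)) := by gcongr
          _ = _ := by rw [Real.exp_add]; ring
    _ = (∫ s, Real.exp (-(ε * s)) * η s) * Real.exp p.2.2 * -(4 * ε * sSup (u '' cylD N)) := by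
        ring
    _ ≤ _ := mul_le_mul_of_nonneg_left hest' (mul_nonneg hC0 (Real.exp_pos _).le)
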